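/- arXiv:2405.07588 — 6 statements merged into one kernel-verified Lean document; each statement's English description precedes it below -/
import Mathlib

section
/- Let G = (V, E) be a finite graph, let X ⊆ V be a shattered set, let Y ⊆ X, and let Y' = {v ∈ V : N[v] ∩ X = Y} be the set of vertices whose trace on X equals Y. Then every shattered set Z with X ⊆ Z satisfies 2^{|Z| − |X|} ≤ |Y'|. -/
/-- The closed neighborhood `N[v]` of a vertex `v` in a simple graph. -/
def closedNbhd {V : Type*} (G : SimpleGraph V) (v : V) : Set V :=
  insert v (G.neighborSet v)

/-- A set `X` of vertices is shattered if every subset of `X` is the trace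
`N[v] ∩ X` of the closed neighborhood of some vertex `v`. -/
def Shattered {V : Type*} (G : SimpleGraph V) (X : Set V) : Prop :=
  ∀ Y ⊆ X, ∃ v, closedNbhd G v ∩ X = Y

theorem stmt_0 {V : Type*} [Fintype V] (G : SimpleGraph V)
    (X Y Z : Set V) (hX : Shattered G X) (hYX : Y ⊆ X)
    (hZ : Shattered G Z) (hXZ : X ⊆ Z) :
    2 ^ (Z.ncard - X.ncard) ≤ {v : V | closedNbhd G v ∩ X = Y}.ncard := by
  rw [← Set.ncard_sdiff hXZ, ← Set.ncard_powerset]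
  have hsub : 𝒫 (Z \ X) ⊆
      (fun v => closedNbhd G v ∩ (Z \ X)) '' {v : V | closedNbhd G v ∩ X = Y} := by
    intro W hW
    have hW' : W ⊆ Z \ X := hW
    obtain ⟨v, hv⟩ := hZ (Y ∪ W)
      (Set.union_subset (hYX.trans hXZ) (hW'.trans Set.sdiff_subset))
    have h : ∀ u, (u ∈ closedNbhd G v ∧ u ∈ Z) ↔ (u ∈ Y ∨ u ∈ W) := fun u =>
      Set.ext_iff.mp hv u
    refine ⟨v, ?_, ?_⟩
    · ext u
      have h₁ := h u
      have h₂ := @hYX u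
      have h₃ := @hXZ u
      have h₄ := @hW' u
      simp only [Set.mem_inter_iff, Set.mem_sdiff] at *
      tauto
    · ext u
      have h₁ := h u
      have h₂ := @hYX u
      have h₄ := @hW' u
      simp only [Set.mem_inter_iff, Set.mem_sdiff] at *
      tauto
  exact (Set.ncard_le_ncard hsub (Set.toFinite _)).trans (Set.ncard_image_le (Set.toFinite _))
end

section
/- Let G = (V, E) be a finite graph and let Z ⊆ V be a shattered set containing a vertex x. Then |Z| ≤ ⌊log₂ deg(x)⌋ + 1, where deg(x) = |N[x]|; equivalently, 2^{|Z| − 1} ≤ |N[x]|. -/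
theorem mem_closedNbhd_comm {V : Type*} {G : SimpleGraph V} {u v : V} :
    u ∈ closedNbhd G v ↔ v ∈ closedNbhd G u := by
  simp [closedNbhd, eq_comm, G.adj_comm]

theorem Shattered.two_pow_ncard_sub_one_le {V : Type*} [Finite V] {G : SimpleGraph V}
    {Z : Set V} {x : V} (hZ : Shattered G Z) (hx : x ∈ Z) :
    2 ^ (Z.ncard - 1) ≤ (closedNbhd G x).ncard := by
  have : Nonempty V := ⟨x⟩
  choose! f hf using hZ
  have hsub {Y : Set V} (hY : Y ∈ 𝒫 (Z \ {x})) : insert x Y ⊆ Z :=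
    Set.insert_subset hx (hY.trans Set.sdiff_subset)
  rw [← Set.ncard_sdiff_singleton_of_mem hx, ← Set.ncard_powerset _]
  refine Set.ncard_le_ncard_of_injOn (fun Y => f (insert x Y)) (fun Y hY => ?_)
    (fun Y hY Y' hY' h => ?_)
  · have hmem : x ∈ closedNbhd G (f (insert x Y)) ∩ Z :=
      (hf _ (hsub hY)).symm ▸ Set.mem_insert x Y
    exact mem_closedNbhd_comm.1 hmem.1
  · have h : f (insert x Y) = f (insert x Y') := h
    have heq : insert x Y = insert x Y' := by
      rw [← hf _ (hsub hY), ← hf _ (hsub hY'), h]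
    have hxY : x ∉ Y := fun hxY => (hY hxY).2 rfl
    have hxY' : x ∉ Y' := fun hxY' => (hY' hxY').2 rfl
    rw [← Set.insert_sdiff_self_of_notMem hxY, heq, Set.insert_sdiff_self_of_notMem hxY']

theorem stmt_1 {V : Type*} [Fintype V] (G : SimpleGraph V)
    (Z : Set V) (x : V) (hZ : Shattered G Z) (hx : x ∈ Z) :
    Z.ncard ≤ Nat.log 2 (closedNbhd G x).ncard + 1 ∧
      2 ^ (Z.ncard - 1) ≤ (closedNbhd G x).ncard := by
  have h := hZ.two_pow_ncard_sub_one_le hx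
  exact ⟨Nat.sub_le_iff_le_add.1 (Nat.le_log_of_pow_le one_lt_two h), h⟩
end

section
/- Let G be a finite graph on n ≥ 1 vertices with at least one edge, with maximum degree Δ = max_v |N[v]|, matching number ν, and degeneracy k. Then VCdim(G) ≤ min{ ⌊log₂ n⌋, ⌊log₂ Δ⌋ + 1, k + 1, ν + 1 }. -/
/-- The VC-dimension of a graph: the maximum cardinality of a shattered set. -/
noncomputable def VCdim {V : Type*} (G : SimpleGraph V) : ℕ :=
  sSup {n | ∃ X : Set V, Shattered G X ∧ X.ncard = n}

/-- A graph is `k`-degenerate if every nonempty (induced) subgraph contains a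
vertex with at most `k` neighbors (within that subgraph). -/
def IsDegenerate {V : Type*} (G : SimpleGraph V) (k : ℕ) : Prop :=
  ∀ S : Set V, S.Nonempty → ∃ v ∈ S, (G.neighborSet v ∩ S).ncard ≤ k

/-- A matching: a set of edges of `G` that are pairwise vertex-disjoint. -/
def IsMatchingSet {V : Type*} (G : SimpleGraph V) (M : Set (Sym2 V)) : Prop :=
  M ⊆ G.edgeSet ∧ ∀ e ∈ M, ∀ f ∈ M, e ≠ f → ∀ v : V, ¬(v ∈ e ∧ v ∈ f)

theorem mem_closedNbhd {V : Type*} {G : SimpleGraph V} {u v : V} :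
    u ∈ closedNbhd G v ↔ u = v ∨ G.Adj v u := by
  simp [closedNbhd]

/-- A shattered set admits a choice of a vertex realizing each trace. -/
theorem Shattered.exists_trace {V : Type*} {G : SimpleGraph V} {X : Set V}
    (hX : Shattered G X) :
    ∃ w : Set V → V, (∀ Y ⊆ X, closedNbhd G (w Y) ∩ X = Y) ∧ Set.InjOn w (𝒫 X) := by
  classical
  choose w hw using hX
  have key : ∀ Y ⊆ X, closedNbhd G (if h : Y ⊆ X then w Y h else w ∅ (Set.empty_subset X)) ∩ X
      = Y := fun Y hY ↦ by simpa [hY] using hw Y hY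
  refine ⟨_, key, fun Y hY Z hZ h ↦ ?_⟩
  rw [← key Y hY, ← key Z hZ]
  exact congrArg (closedNbhd G · ∩ X) h

theorem Shattered.two_pow_le_card {V : Type*} [Fintype V] {G : SimpleGraph V} {X : Set V}
    (hX : Shattered G X) : 2 ^ X.ncard ≤ Fintype.card V := by
  obtain ⟨w, -, hinj⟩ := hX.exists_trace
  rw [← Set.ncard_powerset X (Set.toFinite X), ← Nat.card_eq_fintype_card, ← Set.ncard_univ]
  exact Set.ncard_le_ncard_of_injOn w (fun _ _ ↦ Set.mem_univ _) hinj

theorem Shattered.two_pow_pred_le_ncard_closedNbhd {V : Type*} [Finite V] {G : SimpleGraph V}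
    {X : Set V} (hX : Shattered G X) {x : V} (hx : x ∈ X) :
    2 ^ (X.ncard - 1) ≤ (closedNbhd G x).ncard := by
  obtain ⟨w, hw, hinj⟩ := hX.exists_trace
  rw [← Set.ncard_sdiff_singleton_of_mem hx, ← Set.ncard_powerset _ (Set.toFinite _)]
  have hsub : ∀ Y ∈ 𝒫 (X \ {x}), insert x Y ⊆ X := fun Y hY ↦
    Set.insert_subset hx (hY.trans Set.sdiff_subset)
  refine Set.ncard_le_ncard_of_injOn (fun Y ↦ w (insert x Y)) (fun Y hY ↦ ?_)
    (fun Y hY Z hZ h ↦ ?_) (Set.toFinite _)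
  · have : x ∈ closedNbhd G (w (insert x Y)) ∩ X := by
      rw [hw _ (hsub Y hY)]
      exact Set.mem_insert x Y
    exact mem_closedNbhd_comm.1 this.1
  · have hYZ : insert x Y = insert x Z := hinj (hsub Y hY) (hsub Z hZ) h
    have hxY : x ∉ Y := fun h ↦ (hY h).2 rfl
    have hxZ : x ∉ Z := fun h ↦ (hZ h).2 rfl
    rw [← Set.insert_sdiff_self_of_notMem hxY, hYZ, Set.insert_sdiff_self_of_notMem hxZ]

theorem Shattered.ncard_le_of_isDegenerate {V : Type*} [Finite V] {G : SimpleGraph V}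
    {X : Set V} (hX : Shattered G X) {k : ℕ} (hk : IsDegenerate G k) : X.ncard ≤ k + 1 := by
  obtain ⟨w, hw, hinj⟩ := hX.exists_trace
  rcases X.eq_empty_or_nonempty with rfl | hne
  · simp
  set S : Set V := X ∪ {v | X.ncard ≤ (closedNbhd G v ∩ X).ncard + 1}
  obtain ⟨v, hvS, hv⟩ := hk S (hne.mono Set.subset_union_left)
  have hle : X.ncard ≤ (G.neighborSet v ∩ S).ncard + 1 := by
    by_cases hvX : v ∈ X
    · -- the traces `X \ {y}` for `y ≠ v`, together with `X`, are realized in `N[v] ∩ S`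
      have hmaps : ∀ y ∈ X, w (X \ ({y} \ {v})) ∈ insert v (G.neighborSet v ∩ S) := by
        intro y hy
        have htr := hw (X \ ({y} \ {v})) Set.sdiff_subset
        have h1 : v ∈ closedNbhd G (w (X \ ({y} \ {v}))) ∩ X := by
          rw [htr]
          exact ⟨hvX, fun h ↦ h.2 rfl⟩
        rcases mem_closedNbhd.1 (mem_closedNbhd_comm.1 h1.1) with h | h
        · exact Or.inl h
        · refine Or.inr ⟨h, Or.inr ?_⟩
          rw [Set.mem_ofPred_eq, htr]
          have h2 : X \ {y} ⊆ X \ ({y} \ {v}) := Set.sdiff_subset_sdiff_right Set.sdiff_subset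
          have h3 := Set.ncard_le_ncard h2 (Set.toFinite _)
          have h4 := Set.ncard_sdiff_singleton_add_one hy (Set.toFinite _)
          omega
      have hinj' : Set.InjOn (fun y ↦ w (X \ ({y} \ {v}))) X := by
        intro y hy z hz h
        have hyz : X \ ({y} \ {v}) = X \ ({z} \ {v}) := hinj Set.sdiff_subset Set.sdiff_subset h
        have h1 := Set.ext_iff.1 hyz y
        have h2 := Set.ext_iff.1 hyz z
        simp only [Set.mem_sdiff, Set.mem_singleton_iff] at h1 h2
        grind
      exact (Set.ncard_le_ncard_of_injOn _ hmaps hinj' (Set.toFinite _)).trans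
        (Set.ncard_insert_le _ _)
    · have h1 : X.ncard ≤ (closedNbhd G v ∩ X).ncard + 1 := hvS.resolve_left hvX
      have h2 : closedNbhd G v ∩ X ⊆ G.neighborSet v ∩ S := by
        rintro u ⟨hu, huX⟩
        refine ⟨(mem_closedNbhd.1 hu).resolve_left ?_, Or.inl huX⟩
        rintro rfl
        exact hvX huX
      have h3 := Set.ncard_le_ncard h2 (Set.toFinite _)
      omega
  omega

/-- A family of edges joining distinct vertices of `T` to distinct vertices outside `X ⊇ T` is a
matching. -/
theorem exists_isMatchingSet_of_injOn {V : Type*} {G : SimpleGraph V} {X T : Set V} (hT : T ⊆ X)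
    {f : V → V} (hf : Set.InjOn f T) (hadj : ∀ x ∈ T, G.Adj x (f x)) (hfX : ∀ x ∈ T, f x ∉ X) :
    ∃ M : Set (Sym2 V), IsMatchingSet G M ∧ M.ncard = T.ncard := by
  refine ⟨(fun x ↦ s(x, f x)) '' T, ⟨?_, ?_⟩, Set.InjOn.ncard_image ?_⟩
  · rintro _ ⟨x, hx, rfl⟩
    exact hadj x hx
  · rintro _ ⟨x, hx, rfl⟩ _ ⟨y, hy, rfl⟩ hne v ⟨hvx, hvy⟩
    apply hne
    suffices x = y by rw [this]
    have := hfX x hx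
    have := hfX y hy
    have := hT hx
    have := hT hy
    rcases Sym2.mem_iff.1 hvx with h1 | h1 <;> rcases Sym2.mem_iff.1 hvy with h2 | h2
    · exact h1.symm.trans h2
    · grind
    · grind
    · exact hf hx hy (h1.symm.trans h2)
  · intro x hx y hy h
    have hmem : x ∈ s(y, f y) := by
      rw [← show s(x, f x) = s(y, f y) from h]
      exact Sym2.mem_mk_left _ _
    rcases Sym2.mem_iff.1 hmem with h' | h'
    · exact h'
    · exact absurd (h' ▸ hT hx) (hfX y hy)

theorem Shattered.exists_isMatchingSet {V : Type*} {G : SimpleGraph V} {X : Set V}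
    (hX : Shattered G X) (hne : X.Nonempty) :
    ∃ M : Set (Sym2 V), IsMatchingSet G M ∧ M.ncard = X.ncard - 1 := by
  classical
  obtain ⟨w, hw, hinj⟩ := hX.exists_trace
  have self_mem : ∀ Y ⊆ X, w Y ∈ X → w Y ∈ Y := fun Y hY h ↦
    (hw Y hY).subset ⟨mem_closedNbhd.2 (Or.inl rfl), h⟩
  obtain ⟨x₀, hx₀, hiso⟩ : ∃ x₀ ∈ X, (∃ x ∈ X, w {x} = x) → w {x₀} = x₀ := by
    by_cases h : ∃ x ∈ X, w {x} = x
    · obtain ⟨x, hx, hwx⟩ := h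
      exact ⟨x, hx, fun _ ↦ hwx⟩
    · obtain ⟨x, hx⟩ := hne
      exact ⟨x, hx, fun h' ↦ absurd h' h⟩
  -- a vertex `x` realizing its own trace `{x}` has no neighbor in `X`
  have isolated : ∀ x ∈ X, w {x} = x → ∀ y ∈ closedNbhd G x, y ∈ X → y = x := by
    intro x hx hwx y hy hyX
    have := hw {x} (Set.singleton_subset_iff.2 hx)
    rw [hwx] at this
    exact this.subset ⟨hy, hyX⟩
  let Y : V → Set V := fun x ↦ if w {x} = x then {x₀, x} else {x}
  have hYX : ∀ x ∈ X, Y x ⊆ X := by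
    intro x hx
    by_cases h : w {x} = x <;> simp [Y, h, hx, hx₀, Set.insert_subset_iff]
  have hmem : ∀ x, x ∈ Y x := by
    intro x
    by_cases h : w {x} = x <;> simp [Y, h]
  have hout : ∀ x ∈ X \ {x₀}, w (Y x) ∉ X := by
    rintro x ⟨hx, hxx₀⟩ hwX
    have hwY := self_mem _ (hYX x hx) hwX
    by_cases h : w {x} = x
    · have hw₀ := hiso ⟨x, hx, h⟩
      have htr := hw _ (hYX x hx)
      have hYx : Y x = {x₀, x} := if_pos h
      have hx₀mem : x₀ ∈ closedNbhd G (w (Y x)) := (htr.symm.subset (by simp [hYx])).1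
      have hxmem : x ∈ closedNbhd G (w (Y x)) := (htr.symm.subset (hmem x)).1
      have e1 := isolated x₀ hx₀ hw₀ _ (mem_closedNbhd_comm.1 hx₀mem) hwX
      have e2 := isolated x hx h _ (mem_closedNbhd_comm.1 hxmem) hwX
      exact hxx₀ (e2.symm.trans e1)
    · have hYx : Y x = {x} := if_neg h
      rw [hYx] at hwY
      exact h hwY
  have hinjY : Set.InjOn (fun x ↦ w (Y x)) (X \ {x₀}) := by
    rintro x ⟨hx, hxx₀⟩ y ⟨hy, hyx₀⟩ h
    have hYY : Y x = Y y := hinj (hYX x hx) (hYX y hy) h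
    have h1 : x ∈ Y y := hYY ▸ hmem x
    by_cases hwy : w {y} = y
    · simp only [Y, if_pos hwy] at h1
      exact h1.resolve_left hxx₀
    · simpa [Y, hwy] using h1
  have hadj : ∀ x ∈ X \ {x₀}, G.Adj x (w (Y x)) := by
    intro x hx
    have hxmem : x ∈ closedNbhd G (w (Y x)) := ((hw _ (hYX x hx.1)).symm.subset (hmem x)).1
    refine (mem_closedNbhd.1 (mem_closedNbhd_comm.1 hxmem)).resolve_left fun h ↦ ?_
    exact hout x hx (h.symm ▸ hx.1 : w (Y x) ∈ X)
  rw [← Set.ncard_sdiff_singleton_of_mem hx₀]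
  exact exists_isMatchingSet_of_injOn Set.sdiff_subset hinjY hadj hout

theorem stmt_2 {V : Type*} [Fintype V] [Nonempty V] (G : SimpleGraph V)
    (hE : G.edgeSet.Nonempty)
    (Δ k ν : ℕ)
    (hΔ : IsGreatest {d | ∃ v : V, (closedNbhd G v).ncard = d} Δ)
    (hk : IsLeast {k' | IsDegenerate G k'} k)
    (hν : IsGreatest {n | ∃ M : Set (Sym2 V), IsMatchingSet G M ∧ M.ncard = n} ν) :
    VCdim G ≤
      min (min (Nat.log 2 (Fintype.card V)) (Nat.log 2 Δ + 1)) (min (k + 1) (ν + 1)) := by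
  refine csSup_le' ?_
  rintro _ ⟨X, hX, rfl⟩
  rcases X.eq_empty_or_nonempty with rfl | hne
  · simp
  refine le_min (le_min ?_ ?_) (le_min (hX.ncard_le_of_isDegenerate hk.1) ?_)
  · exact Nat.le_log_of_pow_le one_lt_two hX.two_pow_le_card
  · obtain ⟨x, hx⟩ := hne
    have h := (hX.two_pow_pred_le_ncard_closedNbhd hx).trans (hΔ.2 ⟨x, rfl⟩)
    exact Nat.sub_le_iff_le_add.1 (Nat.le_log_of_pow_le one_lt_two h)
  · exact Nat.sub_le_iff_le_add.1 (hν.2 (hX.exists_isMatchingSet hne))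
end

section
/- Let G be a finite split graph whose vertex set is partitioned into a clique C and an independent set S. Then every shattered set Y of G with |Y| ≥ 3 satisfies either Y ⊆ C or Y ⊆ S. -/
theorem mem_closedNbhd_of_isClique {V : Type*} {G : SimpleGraph V} {C : Set V}
    (hC : G.IsClique C) {u v : V} (hu : u ∈ C) (hv : v ∈ C) : u ∈ closedNbhd G v := by
  rw [mem_closedNbhd]
  by_cases h : u = v
  · exact Or.inl h
  · exact Or.inr (hC hv hu (Ne.symm h))

theorem eq_of_mem_closedNbhd_of_independent {V : Type*} {G : SimpleGraph V} {S : Set V}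
    (hS : ∀ a ∈ S, ∀ b ∈ S, ¬ G.Adj a b) {u v : V} (hu : u ∈ S) (hv : v ∈ S)
    (h : u ∈ closedNbhd G v) : u = v :=
  (mem_closedNbhd.1 h).resolve_right (hS v hv u hu)

/-- In a shattered set, membership in a closed neighborhood can be prescribed by any predicate. -/
theorem Shattered.exists_forall_mem_iff {V : Type*} {G : SimpleGraph V} {X : Set V}
    (hX : Shattered G X) (p : V → Prop) : ∃ v, ∀ u ∈ X, u ∈ closedNbhd G v ↔ p u := by
  obtain ⟨v, hv⟩ := hX {u ∈ X | p u} (Set.sep_subset _ _)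
  refine ⟨v, fun u hu => ?_⟩
  have := Set.ext_iff.1 hv u
  simpa [hu] using this

theorem stmt_10 {V : Type*} [Fintype V] (G : SimpleGraph V) (C S : Set V)
    (hpart : ∀ v : V, v ∈ C ∨ v ∈ S) (hdisj : ∀ v : V, ¬(v ∈ C ∧ v ∈ S))
    (hC : G.IsClique C) (hS : ∀ a ∈ S, ∀ b ∈ S, ¬ G.Adj a b)
    (Y : Set V) (hY : Shattered G Y) (h3 : 3 ≤ Y.ncard) :
    Y ⊆ C ∨ Y ⊆ S := by
  by_contra! h
  obtain ⟨s, hsY, hsC⟩ := Set.not_subset.1 h.1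
  obtain ⟨c, hcY, hcS⟩ := Set.not_subset.1 h.2
  have hs : s ∈ S := (hpart s).resolve_left hsC
  have hc : c ∈ C := (hpart c).resolve_right hcS
  have hsc : s ≠ c := fun e => hcS (e ▸ hs)
  obtain ⟨z, hzY, hz⟩ : ∃ z ∈ Y, z ∉ ({s, c} : Set V) :=
    Set.exists_mem_notMem_of_ncard_lt_ncard ((Set.ncard_pair hsc).trans_lt h3)
  obtain ⟨hzs, hzc⟩ : z ≠ s ∧ z ≠ c := by simpa using hz
  rcases hpart z with hzC | hzS
  · -- Both traces `{s}` and `{s, c}` can only come from the vertex `s` itself.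
    obtain ⟨v, hv⟩ := hY.exists_forall_mem_iff (· = s)
    obtain ⟨w, hw⟩ := hY.exists_forall_mem_iff (· ≠ z)
    have hvS : v ∈ S := (hpart v).resolve_left fun hvC =>
      hzs ((hv z hzY).1 (mem_closedNbhd_of_isClique hC hzC hvC))
    have hwS : w ∈ S := (hpart w).resolve_left fun hwC =>
      (hw z hzY).1 (mem_closedNbhd_of_isClique hC hzC hwC) rfl
    have hsv := eq_of_mem_closedNbhd_of_independent hS hs hvS ((hv s hsY).2 rfl)
    have hsw := eq_of_mem_closedNbhd_of_independent hS hs hwS ((hw s hsY).2 hzs.symm)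
    have hcw := (hw c hcY).2 hzc.symm
    rw [← hsw, hsv] at hcw
    exact hsc ((hv c hcY).1 hcw).symm
  · -- No vertex has a trace containing `s` and `z` but not `c`.
    obtain ⟨v, hv⟩ := hY.exists_forall_mem_iff (· ≠ c)
    have hvS : v ∈ S := (hpart v).resolve_left fun hvC =>
      (hv c hcY).1 (mem_closedNbhd_of_isClique hC hc hvC) rfl
    have hsv := eq_of_mem_closedNbhd_of_independent hS hs hvS ((hv s hsY).2 hsc)
    have hzv := eq_of_mem_closedNbhd_of_independent hS hzS hvS ((hv z hzY).2 hzc)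
    exact hzs (hzv.trans hsv.symm)
end

section
/- Let G = (V, E) be a finite graph and k ≤ |V| a natural number. Then G contains a clique of size k if and only if there is a shattered subset of size k in the set system (X, 𝓡), where X = V × {1, …, k} and 𝓡 = 𝓡₀ ∪ 𝓡₁ ∪ 𝓡₂ ∪ 𝓡₃ with 𝓡₀ = {∅}; 𝓡₁ = {{(v,i)} : v ∈ V, 1 ≤ i ≤ k}; 𝓡₂ = {{(u,i),(v,j)} : uv ∈ E, 1 ≤ i,j ≤ k}; and 𝓡₃ = {{(v,i) : v ∈ V, i ∈ S} : S ⊆ {1,…,k}, |S| ≥ 3}. -/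
/-- A set `Y` is shattered in a set system given by the family `R` of ranges
if every subset of `Y` is the trace `S ∩ Y` of some range `S ∈ R`. -/
def SysShattered {β : Type*} (R : Set (Set β)) (Y : Set β) : Prop :=
  ∀ Z ⊆ Y, ∃ S ∈ R, S ∩ Y = Z

/-- `R₀ = {∅}`. -/
def R0 (V : Type*) (k : ℕ) : Set (Set (V × Fin k)) := {∅}

/-- `R₁ = { {(v,i)} : v ∈ V, i ∈ {1,…,k} }`. -/
def R1 (V : Type*) (k : ℕ) : Set (Set (V × Fin k)) :=
  {P | ∃ (v : V) (i : Fin k), P = {(v, i)}}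

/-- `R₂ = { {(u,i),(v,j)} : uv ∈ E, i,j ∈ {1,…,k} }`. -/
def R2 {V : Type*} (G : SimpleGraph V) (k : ℕ) : Set (Set (V × Fin k)) :=
  {P | ∃ (u v : V) (i j : Fin k), G.Adj u v ∧ P = {(u, i), (v, j)}}

/-- `R₃ = { {(v,i) : v ∈ V, i ∈ S} : S ⊆ {1,…,k}, |S| ≥ 3 }`. -/
def R3 (V : Type*) (k : ℕ) : Set (Set (V × Fin k)) :=
  {P | ∃ S : Set (Fin k), 3 ≤ S.ncard ∧ P = {p : V × Fin k | p.2 ∈ S}}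

/-- The family `𝓡 = 𝓡₀ ∪ 𝓡₁ ∪ 𝓡₂ ∪ 𝓡₃` of the Downey et al. reduction. -/
def RR {V : Type*} (G : SimpleGraph V) (k : ℕ) : Set (Set (V × Fin k)) :=
  R0 V k ∪ R1 V k ∪ R2 G k ∪ R3 V k

/-- A range from `R₀ ∪ R₁ ∪ R₂` has at most two elements, so a larger trace comes from `R₃`. -/
theorem mem_R3_of_mem_RR {V : Type*} {G : SimpleGraph V} {k : ℕ} {P : Set (V × Fin k)}
    (hP : P ∈ RR G k) (hcard : 2 < P.ncard) : P ∈ R3 V k := by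
  rcases hP with ((rfl | ⟨v, i, rfl⟩) | ⟨u, v, i, j, -, rfl⟩) | hP
  · simp at hcard
  · simp at hcard
  · have hle := Set.ncard_insert_le (u, i) {(v, j)}
    rw [Set.ncard_singleton] at hle
    lia
  · exact hP

/-- In a shattered set of size at least four, distinct elements have distinct indices. -/
theorem SysShattered.injOn_snd {V : Type*} [Finite V] {G : SimpleGraph V} {k : ℕ}
    {Y : Set (V × Fin k)} (hY : SysShattered (RR G k) Y) (hcard : 4 ≤ Y.ncard) :
    Set.InjOn Prod.snd Y := by
  intro x hx y hy hxy
  by_contra hne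
  have hsub : {x} ⊆ Y \ {y} := by
    rintro _ rfl
    exact ⟨hx, hne⟩
  have hdiff : 3 ≤ (Y \ {y}).ncard := by
    rw [Set.ncard_sdiff_singleton_of_mem hy]
    lia
  obtain ⟨Z, hxZ, hZY, hZ⟩ :=
    Set.exists_subsuperset_card_eq hsub (n := 3) (by simp) hdiff
  obtain ⟨P, hP, hPZ⟩ := hY Z (hZY.trans Set.sdiff_subset)
  have hle : Z.ncard ≤ P.ncard :=
    Set.ncard_le_ncard (hPZ ▸ Set.inter_subset_left) (Set.toFinite P)
  obtain ⟨S, -, rfl⟩ := mem_R3_of_mem_RR hP (by lia)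
  have hxS : x.2 ∈ S := by
    have hmem : x ∈ {p : V × Fin k | p.2 ∈ S} ∩ Y := hPZ ▸ hxZ rfl
    exact hmem.1
  have hyZ : y ∈ Z := hPZ ▸ ⟨show y.2 ∈ S from hxy ▸ hxS, hy⟩
  exact (hZY hyZ).2 rfl

/-- Distinct elements of a shattered set of size `k` lie over adjacent vertices. -/
theorem SysShattered.adj {V : Type*} [Finite V] {G : SimpleGraph V} {k : ℕ}
    {Y : Set (V × Fin k)} (hY : SysShattered (RR G k) Y) (hcard : Y.ncard = k)
    {a b : V × Fin k} (ha : a ∈ Y) (hb : b ∈ Y) (hab : a ≠ b) : G.Adj a.1 b.1 := by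
  obtain ⟨P, hP, hPab⟩ := hY {a, b} (Set.pair_subset ha hb)
  have haP : a ∈ P := (hPab.symm ▸ Set.mem_insert a {b} : a ∈ P ∩ Y).1
  have hbP : b ∈ P := (hPab.symm ▸ Set.mem_insert_of_mem a rfl : b ∈ P ∩ Y).1
  rcases hP with ((rfl | ⟨v, i, rfl⟩) | ⟨u, v, i, j, huv, rfl⟩) | ⟨S, hS, rfl⟩
  · exact haP.elim
  · exact absurd (haP.trans hbP.symm) hab
  · rcases haP with rfl | rfl <;> rcases hbP with rfl | rfl
    · exact absurd rfl hab
    · exact huv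
    · exact huv.symm
    · exact absurd rfl hab
  · exfalso
    have hSk : S.ncard ≤ k := by simpa using Set.ncard_le_card S
    have hpair : ({a, b} : Set (V × Fin k)).ncard = 2 := Set.ncard_pair hab
    rcases hSk.eq_or_lt with heq | hlt
    · have huniv : S = Set.univ := (Set.eq_univ_iff_ncard S).mpr (by simpa using heq)
      have hYab : Y = {a, b} := by simpa [huniv] using hPab
      rw [← hYab] at hpair
      lia
    · have hinj := hY.injOn_snd (by lia)
      have himage : Prod.snd '' Y = Set.univ :=
        (Set.eq_univ_iff_ncard _).mpr (by simp [hinj.ncard_image, hcard])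
      have hsub : S ⊆ Prod.snd '' ({a, b} : Set (V × Fin k)) := by
        intro i hi
        obtain ⟨y, hy, rfl⟩ : i ∈ Prod.snd '' Y := himage ▸ Set.mem_univ i
        exact ⟨y, hPab ▸ ⟨hi, hy⟩, rfl⟩
      have hle := Set.ncard_le_ncard hsub
      have hle' := Set.ncard_image_le (f := Prod.snd) (Set.toFinite ({a, b} : Set (V × Fin k)))
      lia

/-- Numbering the vertices of a clique gives a shattered set. -/
theorem sysShattered_range {V : Type*} {G : SimpleGraph V} {k : ℕ} {f : Fin k → V}
    (hf : Pairwise fun i j => G.Adj (f i) (f j)) :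
    SysShattered (RR G k) (Set.range fun i => (f i, i)) := by
  intro Z hZ
  obtain ⟨T, rfl⟩ : ∃ T : Set (Fin k), (fun i => (f i, i)) '' T = Z :=
    Set.subset_range_iff_exists_image_eq.mp hZ
  by_cases hT : 3 ≤ T.ncard
  · refine ⟨_, Or.inr ⟨T, hT, rfl⟩, ?_⟩
    ext p
    constructor
    · rintro ⟨hp, i, rfl⟩
      exact ⟨i, hp, rfl⟩
    · rintro ⟨i, hi, rfl⟩
      exact ⟨hi, i, rfl⟩
  · refine ⟨_, Or.inl ?_, Set.inter_eq_left.mpr hZ⟩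
    obtain h | h | h : T.ncard = 0 ∨ T.ncard = 1 ∨ T.ncard = 2 := by lia
    · obtain rfl : T = ∅ := (Set.ncard_eq_zero).mp h
      exact Or.inl (Or.inl (Set.image_empty _))
    · obtain ⟨i, rfl⟩ := Set.ncard_eq_one.mp h
      exact Or.inl (Or.inr ⟨f i, i, Set.image_singleton⟩)
    · obtain ⟨i, j, hij, rfl⟩ := Set.ncard_eq_two.mp h
      exact Or.inr ⟨f i, f j, i, j, hf hij, Set.image_pair _ _ _⟩

theorem stmt_12 {V : Type*} [Fintype V] (G : SimpleGraph V) (k : ℕ)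
    (hk : k ≤ Fintype.card V) :
    (∃ s : Finset V, G.IsNClique k s) ↔
      ∃ Y : Set (V × Fin k), SysShattered (RR G k) Y ∧ Y.ncard = k := by
  constructor
  · rintro ⟨s, hs⟩
    let e : Fin k ≃ s := (s.equivFinOfCardEq hs.card_eq).symm
    refine ⟨Set.range fun i => ((e i : V), i), sysShattered_range fun i j hij => ?_, ?_⟩
    · exact hs.isClique (e i).2 (e j).2 fun h => hij (e.injective (Subtype.ext h))
    · rw [← Set.image_univ, Set.ncard_image_of_injective _ fun i j h => congrArg Prod.snd h]
      simp
  · rintro ⟨Y, hY, hcard⟩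
    classical
    have hinj : Set.InjOn Prod.fst Y := fun a ha b hb h => by
      by_contra hab
      exact (hY.adj hcard ha hb hab).ne h
    refine ⟨(Prod.fst '' Y).toFinset, ?_, ?_⟩
    · rw [Set.coe_toFinset]
      rintro _ ⟨a, ha, rfl⟩ _ ⟨b, hb, rfl⟩ hab
      exact hY.adj hcard ha hb fun h => hab (congrArg Prod.fst h)
    · rw [← Set.ncard_eq_toFinset_card', hinj.ncard_image, hcard]
end

section
/- Let G = (V, E) be a finite graph, let H ⊆ V, and let V' ⊆ V with H ⊆ V' be such that for every vertex v ∈ V there exists v' ∈ V' with N_G[v'] ∩ H = N_G[v] ∩ H. Then for every set X ⊆ H, X is shattered in G if and only if X is shattered in the induced subgraph G[V']. -/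
theorem mem_closedNbhd_induce {V : Type*} (G : SimpleGraph V) (S : Set V) (v u : S) :
    u ∈ closedNbhd (SimpleGraph.induce S G) v ↔ (u : V) ∈ closedNbhd G (v : V) := by
  simp [closedNbhd, Subtype.ext_iff]

theorem stmt_16 {V : Type*} [Fintype V] (G : SimpleGraph V)
    (H V' : Set V) (hHV' : H ⊆ V')
    (hrep : ∀ v : V, ∃ v' ∈ V', closedNbhd G v' ∩ H = closedNbhd G v ∩ H)
    (X : Set V) (hXH : X ⊆ H) :
    Shattered G X ↔ Shattered (SimpleGraph.induce V' G) (Subtype.val ⁻¹' X) := by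
  constructor
  · intro h Y hY
    obtain ⟨v, hv⟩ := h (Subtype.val '' Y) (Set.image_subset_iff.2 hY)
    obtain ⟨v', hv', hN⟩ := hrep v
    refine ⟨⟨v', hv'⟩, ?_⟩
    have hX : closedNbhd G v' ∩ X = Subtype.val '' Y := by
      rw [← hv, ← Set.inter_eq_right.2 hXH, ← Set.inter_assoc, hN, Set.inter_assoc]
    ext u
    have hu := Set.ext_iff.1 hX u
    rw [Subtype.val_injective.mem_set_image] at hu
    rw [← hu, Set.mem_inter_iff, mem_closedNbhd_induce]
    rfl
  · intro h Y hY
    obtain ⟨v, hv⟩ := h (Subtype.val ⁻¹' Y) (Set.preimage_mono hY)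
    refine ⟨v, Set.ext fun u => ?_⟩
    by_cases huX : u ∈ X
    · have hu := Set.ext_iff.1 hv ⟨u, hHV' (hXH huX)⟩
      rw [Set.mem_inter_iff, mem_closedNbhd_induce] at hu
      exact hu
    · exact iff_of_false (fun hu => huX hu.2) fun hu => huX (hY hu)
end
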